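/- Let μ(x) = sin³(x)/8 on (0, π/2), ξ(x) = ∫₀^x μ(s) ds, LΦ = μ^{-1/2}(√μ Φ)', and HΦ = −√μ (μ^{-1}(√μ Φ)')'. There exists a constant C > 0 such that for every smooth compactly supported Φ : (0, π/2) → ℝ and every x ∈ (0, π/2), √(μ(x)) |Φ(x)| ≤ C ξ(x) ( ‖Φ‖_{L²(0,π/2)} + ‖LΦ‖_{L²(0,π/2)} + ‖HΦ‖_{L²(0,π/2)} + ‖L(HΦ)‖_{L²(0,π/2)} + ‖H(HΦ)‖_{L²(0,π/2)} ). -/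

import Mathlib

open Real MeasureTheory

/-- `μ(x) = sin³(x)/8`. -/
noncomputable def muFn (x : ℝ) : ℝ := Real.sin x ^ 3 / 8

/-- `ξ(x) = ∫₀^x μ(s) ds`. -/
noncomputable def xiFn (x : ℝ) : ℝ := ∫ s in (0:ℝ)..x, muFn s

/-- `LΦ = μ^{-1/2} (√μ Φ)'`. -/
noncomputable def Lop (Φ : ℝ → ℝ) (x : ℝ) : ℝ :=
  (Real.sqrt (muFn x))⁻¹ * deriv (fun y => Real.sqrt (muFn y) * Φ y) x

/-- `HΦ = −√μ (μ⁻¹ (√μ Φ)')'`. -/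
noncomputable def Hop (Φ : ℝ → ℝ) (x : ℝ) : ℝ :=
  -Real.sqrt (muFn x) *
    deriv (fun y => (muFn y)⁻¹ * deriv (fun w => Real.sqrt (muFn w) * Φ w) y) x


/-- Smooth functions with support inside `(0, π/2)`. -/
def PP (F : ℝ → ℝ) : Prop :=
  ContDiff ℝ (⊤ : ℕ∞) F ∧ tsupport F ⊆ Set.Ioo 0 (Real.pi / 2)

lemma PP.deriv {F : ℝ → ℝ} (h : PP F) : PP (deriv F) :=
  ⟨h.1.deriv' , (closure_minimal (support_deriv_subset) (isClosed_tsupport F)).trans h.2⟩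

lemma PP.mul {F g : ℝ → ℝ} (h : PP F) (hg : ∀ x ∈ Set.Ioo 0 (Real.pi / 2),
    ContDiffAt ℝ (⊤ : ℕ∞) g x) : PP (fun x => g x * F x) := by
  have hs : tsupport (fun x => g x * F x) ⊆ tsupport F := tsupport_mul_subset_right
  refine ⟨contDiff_iff_contDiffAt.mpr fun x => ?_, hs.trans h.2⟩
  by_cases hx : x ∈ tsupport F
  · exact (hg x (h.2 hx)).mul h.1.contDiffAt
  · have he := notMem_tsupport_iff_eventuallyEq.mp (fun h' => hx (hs h'))
    exact (contDiffAt_const (c := (0:ℝ))).congr_of_eventuallyEq he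

lemma PP.zero {F : ℝ → ℝ} (h : PP F) {x : ℝ} (hx : x ∉ Set.Ioo 0 (Real.pi / 2)) : F x = 0 :=
  image_eq_zero_of_notMem_tsupport fun h' => hx (h.2 h')

lemma PP.bound {F g : ℝ → ℝ} (h : PP F) {a b : ℝ} (hab : a ≤ b)
    (hg : IntervalIntegrable g volume a b) (hb : ∀ s ∈ Set.Ioc a b, |_root_.deriv F s| ≤ g s) :
    |F b - F a| ≤ ∫ s in a..b, g s := by
  rw [← intervalIntegral.integral_deriv_eq_sub
    (fun x _ => (h.1.differentiable (by simp)).differentiableAt)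
    (h.deriv.1.continuous.intervalIntegrable _ _)]
  exact intervalIntegral.norm_integral_le_of_norm_le hab
    (Filter.Eventually.of_forall fun s hs => (Real.norm_eq_abs _).trans_le (hb s hs)) hg

lemma mu_contDiff : ContDiff ℝ (⊤ : ℕ∞) muFn := by
  unfold muFn; fun_prop

lemma mu_lower {x : ℝ} (h0 : 0 ≤ x) (h1 : x ≤ Real.pi / 2) : x ^ 3 / 64 ≤ muFn x := by
  have h := Real.mul_le_sin h0 h1
  have hpi : (1:ℝ) / 2 ≤ 2 / Real.pi := by
    rw [div_le_div_iff₀ (by norm_num) Real.pi_pos]; linarith [Real.pi_le_four]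
  have : x / 2 ≤ Real.sin x := by nlinarith
  have := pow_le_pow_left₀ (by positivity) this 3
  unfold muFn
  nlinarith

lemma mu_upper {x : ℝ} (h0 : 0 ≤ x) (h1 : x ≤ Real.pi / 2) : muFn x ≤ x ^ 3 / 8 := by
  have h := Real.sin_le h0
  have h2 : 0 ≤ Real.sin x := Real.sin_nonneg_of_nonneg_of_le_pi h0 (by linarith [Real.pi_pos])
  have := pow_le_pow_left₀ h2 h 3
  unfold muFn
  linarith

lemma mu_pos {x : ℝ} (h0 : 0 < x) (h1 : x ≤ Real.pi / 2) : 0 < muFn x :=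
  lt_of_lt_of_le (by positivity) (mu_lower h0.le h1)

lemma PP.sqrtmul {F : ℝ → ℝ} (h : PP F) : PP (fun x => Real.sqrt (muFn x) * F x) :=
  h.mul fun _ hx => mu_contDiff.contDiffAt.sqrt (mu_pos hx.1 hx.2.le).ne'

lemma PP.invmul {F : ℝ → ℝ} (h : PP F) : PP (fun x => (muFn x)⁻¹ * F x) :=
  h.mul fun _ hx => mu_contDiff.contDiffAt.inv (mu_pos hx.1 hx.2.le).ne'

lemma PP.Hop {F : ℝ → ℝ} (h : PP F) : PP (Hop F) := by
  have := h.sqrtmul.deriv.invmul.deriv.sqrtmul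
  have h2 := this.mul (g := fun _ => (-1:ℝ)) (fun _ _ => contDiffAt_const)
  convert h2 using 1
  funext x
  simp [_root_.Hop]

/-- The flux `μ⁻¹ (√μ F)'`. -/
noncomputable def vv (F : ℝ → ℝ) (x : ℝ) : ℝ :=
  (muFn x)⁻¹ * deriv (fun w => Real.sqrt (muFn w) * F w) x

lemma Hop_eq (F : ℝ → ℝ) (x : ℝ) : Hop F x = -Real.sqrt (muFn x) * deriv (vv F) x := rfl

lemma PP.vv {F : ℝ → ℝ} (h : PP F) : PP (vv F) := h.sqrtmul.deriv.invmul

lemma dflux_eq (F : ℝ → ℝ) {x : ℝ} (h0 : 0 < x) (h1 : x ≤ Real.pi / 2) :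
    deriv (fun w => Real.sqrt (muFn w) * F w) x = muFn x * vv F x := by
  unfold vv
  rw [mul_inv_cancel_left₀ (mu_pos h0 h1).ne']

lemma vv_end {F : ℝ → ℝ} (h : PP F) : vv F (Real.pi / 2) = 0 := h.vv.zero (by simp)

lemma step1 {G : ℝ → ℝ} (hG : PP G) {K : ℝ} (hK : 0 < K)
    (hI : ∫ y in (0:ℝ)..(Real.pi / 2), (Hop G y) ^ 2 ≤ K ^ 2) {x : ℝ} (h0 : 0 < x)
    (h1 : x ≤ Real.pi / 2) : |vv G x| ≤ 17 * K / x := by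
  have hc : Continuous (fun y => (Hop G y) ^ 2) := hG.Hop.1.continuous.pow 2
  have hmem : (0:ℝ) ∉ Set.uIcc x (Real.pi / 2) := by
    rw [Set.uIcc_of_le h1]; intro h; exact absurd h.1 (not_le.mpr h0)
  have hi3 : IntervalIntegrable (fun s : ℝ => s ^ (-3 : ℤ)) volume x (Real.pi / 2) :=
    intervalIntegral.intervalIntegrable_zpow (Or.inr hmem)
  have hA : IntervalIntegrable (fun s => 1 / (2 * K * x) * (Hop G s) ^ 2) volume x (Real.pi / 2) :=
    (hc.intervalIntegrable _ _).const_mul _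
  have hB : IntervalIntegrable (fun s : ℝ => 32 * K * x * s ^ (-3 : ℤ)) volume x (Real.pi / 2) :=
    hi3.const_mul _
  have key := hG.vv.bound (a := x) (b := Real.pi / 2) h1 (hA.add hB) (by
    intro s hs
    have hs0 : 0 < s := h0.trans hs.1
    have hm := mu_lower hs0.le hs.2
    have hmp := mu_pos hs0 hs.2
    have e : (Hop G s) ^ 2 = muFn s * (deriv (vv G) s) ^ 2 := by
      rw [Hop_eq, mul_pow, neg_sq, Real.sq_sqrt hmp.le]
    show _ ≤ 1 / (2 * K * x) * (Hop G s) ^ 2 + 32 * K * x * s ^ (-3 : ℤ)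
    rw [e, ← sq_abs (deriv (vv G) s)]
    set d := |deriv (vv G) s|
    have hz : s ^ (-3 : ℤ) = 1 / s ^ 3 := by
      rw [zpow_neg, one_div]; norm_cast
    have h3 : 1 / (2 * K * x) * (s ^ 3 / 64 * d ^ 2) ≤ 1 / (2 * K * x) * (muFn s * d ^ 2) := by
      gcongr
    refine le_trans ?_ (add_le_add_left h3 _)
    rw [hz]
    have : 1 / (2 * K * x) * (s ^ 3 / 64 * d ^ 2) + 32 * K * x * (1 / s ^ 3) - d
        = (s ^ 3 * d - 64 * K * x) ^ 2 / (128 * K * x * s ^ 3) := by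
      field_simp
      ring
    have h4 : 0 ≤ (s ^ 3 * d - 64 * K * x) ^ 2 / (128 * K * x * s ^ 3) := by positivity
    linarith)
  rw [vv_end hG, zero_sub, abs_neg] at key
  refine key.trans ?_
  rw [intervalIntegral.integral_add hA hB, intervalIntegral.integral_const_mul,
    intervalIntegral.integral_const_mul, integral_zpow (Or.inr ⟨by norm_num, hmem⟩)]
  have hsub : ∫ y in x..(Real.pi / 2), (Hop G y) ^ 2 ≤ K ^ 2 := by
    refine le_trans ?_ hI
    exact intervalIntegral.integral_mono_interval h0.le h1 le_rfl
      (Filter.Eventually.of_forall fun y => sq_nonneg _) (hc.intervalIntegrable _ _)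
  have e1 : 1 / (2 * K * x) * (∫ y in x..(Real.pi / 2), (Hop G y) ^ 2) ≤ K / (2 * x) := by
    calc _ ≤ 1 / (2 * K * x) * K ^ 2 := by gcongr
      _ = _ := by field_simp
  have hz : ∀ s : ℝ, s ^ ((-3 : ℤ) + 1) = 1 / s ^ 2 := by
    intro s
    rw [show ((-3 : ℤ) + 1) = -2 by norm_num, zpow_neg, one_div]; norm_cast
  rw [hz, hz]
  have hp : 0 ≤ 16 * K * x * (1 / (Real.pi / 2) ^ 2) := by positivity
  have e2 : 32 * K * x * ((1 / (Real.pi / 2) ^ 2 - 1 / x ^ 2) / (((-3 : ℤ) : ℝ) + 1))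
      = 16 * K / x - 16 * K * x * (1 / (Real.pi / 2) ^ 2) := by
    push_cast
    field_simp
    ring
  rw [e2]
  have e3 : K / (2 * x) ≤ K / x := by gcongr; linarith
  have e4 : 17 * K / x = K / x + 16 * K / x := by ring
  linarith

lemma step2 {G : ℝ → ℝ} (hG : PP G) {K : ℝ}
    (hv : ∀ x, 0 < x → x ≤ Real.pi / 2 → |vv G x| ≤ 17 * K / x) (hK : 0 < K) {x : ℝ} (h0 : 0 < x)
    (h1 : x ≤ Real.pi / 2) : |Real.sqrt (muFn x) * G x| ≤ K * x ^ 3 := by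
  have key := hG.sqrtmul.bound (a := 0) (b := x) (g := fun s => 17 / 8 * K * s ^ 2) h0.le
    (by apply Continuous.intervalIntegrable; fun_prop) (by
      intro s hs
      have hs1 := hs.2.trans h1
      have hsp := hs.1
      rw [dflux_eq G hs.1 hs1, abs_mul, abs_of_pos (mu_pos hs.1 hs1)]
      calc _ ≤ s ^ 3 / 8 * (17 * K / s) :=
            mul_le_mul (mu_upper hs.1.le hs1) (hv s hs.1 hs1) (abs_nonneg _) (by positivity)
        _ = _ := by field_simp)
  have hz := hG.sqrtmul.zero (x := 0) (by simp)
  rw [hz, sub_zero, intervalIntegral.integral_const_mul, integral_pow] at key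
  refine key.trans ?_
  have : 0 ≤ K * x ^ 3 := by positivity
  norm_num
  linarith

lemma step3 {F : ℝ → ℝ} (hF : PP F) {K : ℝ}
    (hw : ∀ x, 0 < x → x ≤ Real.pi / 2 → |Real.sqrt (muFn x) * Hop F x| ≤ K * x ^ 3)
    (hK : 0 < K) {x : ℝ} (h0 : 0 < x)
    (h1 : x ≤ Real.pi / 2) : |vv F x| ≤ 128 * K := by
  have key := hF.vv.bound (a := x) (b := Real.pi / 2) (g := fun s => 64 * K) h1
    (by apply Continuous.intervalIntegrable; fun_prop) (by
      intro s hs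
      have hs0 := h0.trans hs.1
      have hmp := mu_pos hs0 hs.2
      have := hw s hs0 hs.2
      rw [Hop_eq, ← mul_assoc, mul_neg, Real.mul_self_sqrt hmp.le, abs_mul, abs_neg,
        abs_of_pos hmp] at this
      have h3 := mul_le_mul_of_nonneg_right (mu_lower hs0.le hs.2) (abs_nonneg (deriv (vv F) s))
      have h4 : 0 < s ^ 3 := by positivity
      refine le_of_mul_le_mul_left ?_ h4
      linarith)
  rw [vv_end hF, zero_sub, abs_neg, intervalIntegral.integral_const, smul_eq_mul] at key
  nlinarith [Real.pi_le_four]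

lemma step4 {F : ℝ → ℝ} (hF : PP F) {K : ℝ}
    (hv : ∀ x, 0 < x → x ≤ Real.pi / 2 → |vv F x| ≤ 128 * K) {x : ℝ} (h0 : 0 < x)
    (h1 : x ≤ Real.pi / 2) : |Real.sqrt (muFn x) * F x| ≤ 128 * K * xiFn x := by
  have key := hF.sqrtmul.bound (a := 0) (b := x) (g := fun s => 128 * K * muFn s) h0.le
    (by
      apply Continuous.intervalIntegrable
      exact continuous_const.mul mu_contDiff.continuous) (by
      intro s hs
      have hs1 := hs.2.trans h1
      have hmp := mu_pos hs.1 hs1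
      rw [dflux_eq F hs.1 hs1, abs_mul, abs_of_pos hmp, mul_comm]
      exact mul_le_mul_of_nonneg_right (hv s hs.1 hs1) hmp.le)
  have hz := hF.sqrtmul.zero (x := 0) (by simp)
  rwa [hz, sub_zero, intervalIntegral.integral_const_mul] at key

/-- Linear vanishing of `√μ Φ` at the vacuum boundary: there is `C > 0` so that for every
smooth compactly supported `Φ` on `(0, π/2)` and every `x ∈ (0, π/2)`,
`√(μ(x)) |Φ(x)| ≤ C ξ(x) (‖Φ‖ + ‖LΦ‖ + ‖HΦ‖ + ‖L(HΦ)‖ + ‖H(HΦ)‖)` in `L²(0, π/2)`. -/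
theorem boundary_linear_vanishing :
    ∃ C > (0:ℝ), ∀ Φ : ℝ → ℝ,
      ContDiff ℝ (⊤ : ℕ∞) Φ → HasCompactSupport Φ → tsupport Φ ⊆ Set.Ioo 0 (Real.pi / 2) →
      ∀ x ∈ Set.Ioo (0:ℝ) (Real.pi / 2),
        Real.sqrt (muFn x) * |Φ x| ≤ C * xiFn x *
          (Real.sqrt (∫ y in (0:ℝ)..(Real.pi / 2), (Φ y) ^ 2)
            + Real.sqrt (∫ y in (0:ℝ)..(Real.pi / 2), (Lop Φ y) ^ 2)
            + Real.sqrt (∫ y in (0:ℝ)..(Real.pi / 2), (Hop Φ y) ^ 2)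
            + Real.sqrt (∫ y in (0:ℝ)..(Real.pi / 2), (Lop (Hop Φ) y) ^ 2)
            + Real.sqrt (∫ y in (0:ℝ)..(Real.pi / 2), (Hop (Hop Φ) y) ^ 2)) := by
  refine ⟨128, by norm_num, fun Φ hΦ _ hs x hx => ?_⟩
  have hP : PP Φ := ⟨hΦ, hs⟩
  have hxi : 0 ≤ xiFn x := intervalIntegral.integral_nonneg hx.1.le fun s hs' =>
    le_trans (by have := hs'.1; positivity) (mu_lower hs'.1 (hs'.2.trans hx.2.le))
  set N := Real.sqrt (∫ y in (0:ℝ)..(Real.pi / 2), (Hop (Hop Φ) y) ^ 2) with hN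
  have hN0 : 0 ≤ N := Real.sqrt_nonneg _
  have hInn : 0 ≤ ∫ y in (0:ℝ)..(Real.pi / 2), (Hop (Hop Φ) y) ^ 2 :=
    intervalIntegral.integral_nonneg (by positivity) fun _ _ => sq_nonneg _
  have main : ∀ K, N < K → Real.sqrt (muFn x) * |Φ x| ≤ 128 * xiFn x * K := by
    intro K hNK
    have hK : 0 < K := hN0.trans_lt hNK
    have hI : ∫ y in (0:ℝ)..(Real.pi / 2), (Hop (Hop Φ) y) ^ 2 ≤ K ^ 2 := by
      rw [← Real.sq_sqrt hInn]
      exact pow_le_pow_left₀ hN0 hNK.le 2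
    have h := step4 hP (fun _ a b => step3 hP (fun _ a b => step2 hP.Hop
      (fun _ a b => step1 hP.Hop hK hI a b) hK a b) hK a b) hx.1 hx.2.le
    rw [abs_mul, abs_of_nonneg (Real.sqrt_nonneg _)] at h
    linarith
  have fin : Real.sqrt (muFn x) * |Φ x| ≤ 128 * xiFn x * N := by
    have ht : Filter.Tendsto (fun K => 128 * xiFn x * K) (nhdsWithin N (Set.Ioi N))
        (nhds (128 * xiFn x * N)) :=
      ((continuous_const.mul continuous_id).tendsto N).mono_left nhdsWithin_le_nhds
    exact ge_of_tendsto ht (by filter_upwards [self_mem_nhdsWithin] with K hK using main K hK)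
  refine fin.trans ?_
  gcongr
  have := Real.sqrt_nonneg (∫ y in (0:ℝ)..(Real.pi / 2), (Φ y) ^ 2)
  have := Real.sqrt_nonneg (∫ y in (0:ℝ)..(Real.pi / 2), (Lop Φ y) ^ 2)
  have := Real.sqrt_nonneg (∫ y in (0:ℝ)..(Real.pi / 2), (Hop Φ y) ^ 2)
  have := Real.sqrt_nonneg (∫ y in (0:ℝ)..(Real.pi / 2), (Lop (Hop Φ) y) ^ 2)
  linarith
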